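/- arXiv:1310.4448 — 2 statements merged into one kernel-verified Lean document; each statement's English description precedes it below -/
import Mathlib

section
/- Let p be a prime and let V = F_{p^2}^4 be equipped with a nondegenerate Hermitian form relative to F_{p^2}/F_p. Then the number of Lagrangian planes in V, i.e., 2-dimensional subspaces U with U = U^⊥, equals (p^3+1)(p+1). -/
/-- A Hermitian form relative to `𝔽_{p²}/𝔽_p`: biadditive, linear in the first
variable and conjugate symmetric with respect to `x ↦ x^p`. -/
def IsHermitianForm (p : ℕ) [Fact p.Prime] {V : Type*} [AddCommGroup V]
    [Module (GaloisField p 2) V] (h : V → V → GaloisField p 2) : Prop :=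
  (∀ x x' y, h (x + x') y = h x y + h x' y) ∧
  (∀ (c : GaloisField p 2) (x y : V), h (c • x) y = c * h x y) ∧
  (∀ x y, h y x = (h x y) ^ p)

open Classical in
/-- The norm `t ↦ t ^ (p + 1)` of `𝔽_{p²}/𝔽_p` takes every nonzero value of `𝔽_p` exactly
`p + 1` times. -/
lemma GaloisField.card_norm_fiber {p : ℕ} [Fact p.Prime] [Fintype (GaloisField p 2)]
    {c : GaloisField p 2} (hc0 : c ≠ 0) (hc : c ^ p = c) :
    (Finset.univ.filter fun t : GaloisField p 2 => t ^ (p + 1) = c).card = p + 1 := by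
  have hp : 2 ≤ p := (Fact.out : p.Prime).two_le
  have hcard : Nat.card (GaloisField p 2)ˣ = (p - 1) * (p + 1) := by
    rw [Nat.card_units, GaloisField.card p 2 two_ne_zero]
    obtain ⟨m, rfl⟩ : ∃ m, p = m + 2 := ⟨p - 2, by omega⟩
    simp only [show m + 2 - 1 = m + 1 by omega]
    rw [Nat.sub_eq_iff_eq_add (Nat.one_le_pow _ _ (by omega))]
    ring
  obtain ⟨g, hg⟩ := IsCyclic.exists_ofOrder_eq_natCard (α := (GaloisField p 2)ˣ)
  have hgen : ∀ x, x ∈ Submonoid.powers g := by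
    intro x
    rw [mem_powers_iff_mem_zpowers, (Subgroup.eq_top_of_card_eq (Subgroup.zpowers g)
      (by rw [Nat.card_zpowers, hg]))]
    trivial
  have hζ : IsPrimitiveRoot (g ^ (p - 1)) (p + 1) := by
    refine (IsPrimitiveRoot.orderOf g).pow ?_ (hg.trans hcard)
    rw [hg]; exact Nat.card_pos
  have hζ' : IsPrimitiveRoot ((g ^ (p - 1) : (GaloisField p 2)ˣ) : GaloisField p 2) (p + 1) :=
    hζ.map_of_injective (f := Units.coeHom _) Units.val_injective
  have hex : ∃ α : GaloisField p 2, α ^ (p + 1) = c := by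
    obtain ⟨k, hk⟩ := hgen (Units.mk0 c hc0)
    have h1 : (Units.mk0 c hc0) ^ (p - 1) = 1 := by
      ext
      have : c * c ^ (p - 1) = c * 1 := by
        rw [← pow_succ', Nat.sub_add_cancel (by omega), hc, mul_one]
      simpa using mul_left_cancel₀ hc0 this
    simp only at hk
    rw [← hk, ← pow_mul] at h1
    have h2 := orderOf_dvd_of_pow_eq_one h1
    rw [hg, hcard, mul_comm k] at h2
    obtain ⟨j, rfl⟩ := Nat.dvd_of_mul_dvd_mul_left (by omega) h2
    refine ⟨(g : GaloisField p 2) ^ j, ?_⟩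
    have := congrArg Units.val hk
    rw [← pow_mul, mul_comm j]
    simpa using this
  have h3 := hζ'.card_nthRoots c
  rw [if_pos hex, ← Multiset.toFinset_card_of_nodup (hζ'.nthRoots_nodup hc0)] at h3
  refine Eq.trans (congrArg Finset.card ?_) h3
  ext t
  simp [Polynomial.mem_nthRoots]

/-- The trace `t ↦ t + t ^ p` of `𝔽_{p²}/𝔽_p` is not identically zero. -/
lemma GaloisField.exists_add_pow_ne_zero (p : ℕ) [Fact p.Prime] :
    ∃ t : GaloisField p 2, t + t ^ p ≠ 0 := by
  have hp : 2 ≤ p := (Fact.out : p.Prime).two_le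
  by_contra! hall
  have hdeg : (Polynomial.X ^ p + Polynomial.X : Polynomial (GaloisField p 2)).natDegree = p := by
    rw [Polynomial.natDegree_add_eq_left_of_natDegree_lt] <;> simp
    omega
  have hne : (Polynomial.X ^ p + Polynomial.X : Polynomial (GaloisField p 2)) ≠ 0 := by
    intro h0
    rw [h0] at hdeg
    simp at hdeg
    omega
  have : Fintype (GaloisField p 2) := Fintype.ofFinite _
  have h1 := Polynomial.card_le_degree_of_subset_roots (p := Polynomial.X ^ p + Polynomial.X)
    (Z := (Finset.univ : Finset (GaloisField p 2))) (by
      intro t _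
      rw [Polynomial.mem_roots hne]
      simpa [add_comm] using hall t)
  rw [hdeg, Finset.card_univ, ← Nat.card_eq_fintype_card, GaloisField.card p 2 two_ne_zero] at h1
  nlinarith

lemma Finset.card_filter_prod_of_forall {X : Type*} [Fintype X] (A : X → Prop) (B : X → X → Prop)
    [DecidablePred A] [∀ x, DecidablePred (B x)] (m : ℕ)
    (hm : ∀ x, A x → (Finset.univ.filter (B x)).card = m) :
    (Finset.univ.filter fun q : X × X => A q.1 ∧ B q.1 q.2).card =
      (Finset.univ.filter A).card * m := by
  rw [← Finset.sum_const_nat (s := Finset.univ.filter A)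
    (fun x hx => hm x (Finset.mem_filter.1 hx).2), ← Finset.card_sigma]
  refine Finset.card_nbij' (fun q => ⟨q.1, q.2⟩) (fun q => (q.1, q.2)) ?_ ?_ ?_ ?_ <;>
    intro q <;> simp

namespace IsHermitianForm

variable {p : ℕ} [Fact p.Prime] {V : Type*} [AddCommGroup V] [Module (GaloisField p 2) V]
  {h : V → V → GaloisField p 2}

/-- The linear functional `x ↦ h x y`. -/
noncomputable def left (hh : IsHermitianForm p h) (y : V) :
    V →ₗ[GaloisField p 2] GaloisField p 2 where
  toFun x := h x y
  map_add' x x' := hh.1 x x' y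
  map_smul' c x := hh.2.1 c x y

@[simp] lemma left_apply (hh : IsHermitianForm p h) (x y : V) : hh.left y x = h x y := rfl

lemma add_right (hh : IsHermitianForm p h) (x y y' : V) : h x (y + y') = h x y + h x y' := by
  rw [hh.2.2, hh.1, add_pow_char, ← hh.2.2, ← hh.2.2]

lemma smul_right (hh : IsHermitianForm p h) (c : GaloisField p 2) (x y : V) :
    h x (c • y) = c ^ p * h x y := by
  rw [hh.2.2, hh.2.1, mul_pow, ← hh.2.2]

lemma zero_left (hh : IsHermitianForm p h) (y : V) : h 0 y = 0 := (hh.left y).map_zero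

lemma eq_zero_comm (hh : IsHermitianForm p h) {x y : V} : h x y = 0 ↔ h y x = 0 := by
  have hp : p ≠ 0 := (Fact.out : p.Prime).ne_zero
  rw [hh.2.2 y x]
  simp [hp]

/-- A Hermitian form that vanishes on the diagonal of a subspace vanishes on the subspace. -/
lemma eq_zero_of_diag (hh : IsHermitianForm p h) {W : Submodule (GaloisField p 2) V}
    (hW : ∀ x ∈ W, h x x = 0) {x y : V} (hx : x ∈ W) (hy : y ∈ W) : h x y = 0 := by
  by_contra hne
  obtain ⟨t, ht⟩ := GaloisField.exists_add_pow_ne_zero p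
  apply ht
  have h1 := hW ((t / h x y) • x + y) (W.add_mem (W.smul_mem _ hx) hy)
  have h2 := hW _ (W.smul_mem (t / h x y) hx)
  have h3 : h ((t / h x y) • x) y = t := by rw [hh.2.1, div_mul_cancel₀ _ hne]
  rw [hh.1, hh.add_right, hh.add_right, h2, hW y hy, hh.2.2 _ y, h3] at h1
  simpa using h1

/-- The vectors of `W` orthogonal to `x`. -/
noncomputable def perp (hh : IsHermitianForm p h) (W : Submodule (GaloisField p 2) V) (x : V) :
    Submodule (GaloisField p 2) V := W ⊓ LinearMap.ker (hh.left x)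

lemma mem_perp (hh : IsHermitianForm p h) {W : Submodule (GaloisField p 2) V} {x y : V} :
    y ∈ hh.perp W x ↔ y ∈ W ∧ h y x = 0 := by simp [perp]

/-- The radical of the restriction of `h` to `W`. -/
noncomputable def radical (hh : IsHermitianForm p h) (W : Submodule (GaloisField p 2) V) :
    Submodule (GaloisField p 2) V := W ⊓ ⨅ z ∈ W, LinearMap.ker (hh.left z)

lemma mem_radical (hh : IsHermitianForm p h) {W : Submodule (GaloisField p 2) V} {y : V} :
    y ∈ hh.radical W ↔ y ∈ W ∧ ∀ z ∈ W, h y z = 0 := by simp [radical]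

lemma radical_eq_self (hh : IsHermitianForm p h) {W : Submodule (GaloisField p 2) V}
    (hW : ∀ x ∈ W, h x x = 0) : hh.radical W = W := by
  ext y
  rw [mem_radical]
  exact ⟨fun hy => hy.1, fun hy => ⟨hy, fun z hz => hh.eq_zero_of_diag hW hy hz⟩⟩

lemma sub_smul_mem_perp (hh : IsHermitianForm p h) {W : Submodule (GaloisField p 2) V} {x z : V}
    (hx : x ∈ W) (hxx : h x x ≠ 0) (hz : z ∈ W) : z - (h z x / h x x) • x ∈ hh.perp W x := by
  refine hh.mem_perp.2 ⟨W.sub_mem hz (W.smul_mem _ hx), ?_⟩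
  rw [← hh.left_apply, map_sub, map_smul, hh.left_apply, hh.left_apply, smul_eq_mul,
    div_mul_cancel₀ _ hxx, sub_self]

lemma radical_perp (hh : IsHermitianForm p h) {W : Submodule (GaloisField p 2) V} {x : V}
    (hx : x ∈ W) (hxx : h x x ≠ 0) : hh.radical (hh.perp W x) = hh.radical W := by
  ext y
  simp only [mem_radical, mem_perp]
  constructor
  · rintro ⟨⟨hy, hyx⟩, hy'⟩
    refine ⟨hy, fun z hz => ?_⟩
    have h1 := hy' _ (hh.mem_perp.1 (hh.sub_smul_mem_perp hx hxx hz))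
    have h2 : h y z = h y (z - (h z x / h x x) • x) + h y ((h z x / h x x) • x) := by
      rw [← hh.add_right, sub_add_cancel]
    rw [h2, h1, hh.smul_right, hyx, mul_zero, add_zero]
  · rintro ⟨hy, hy'⟩
    exact ⟨⟨hy, hy' x hx⟩, fun z hz => hy' z hz.1⟩

lemma finrank_perp [FiniteDimensional (GaloisField p 2) V] (hh : IsHermitianForm p h)
    {W : Submodule (GaloisField p 2) V} {x z : V} (hz : z ∈ W) (hzx : h z x ≠ 0) :
    Module.finrank (GaloisField p 2) (hh.perp W x) + 1 = Module.finrank (GaloisField p 2) W := by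
  have hne : (hh.left x).domRestrict W ≠ 0 := fun h0 =>
    hzx (by simpa using LinearMap.congr_fun h0 ⟨z, hz⟩)
  rw [← Module.Dual.finrank_ker_add_one_of_ne_zero hne]
  congr 1
  have : hh.perp W x = (LinearMap.ker ((hh.left x).domRestrict W)).map W.subtype := by
    ext y
    simp [mem_perp, and_comm]
  rw [this]
  exact LinearEquiv.finrank_eq (Submodule.equivMapOfInjective _ W.injective_subtype _).symm

lemma exists_ne_zero (hh : IsHermitianForm p h) (hnd : ∀ x, (∀ y, h x y = 0) → x = 0) {x : V}
    (hx : x ≠ 0) : ∃ z, h z x ≠ 0 := by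
  by_contra! hall
  exact hx (hnd x fun y => hh.eq_zero_comm.1 (hall y))

lemma radical_top (hh : IsHermitianForm p h) (hnd : ∀ x, (∀ y, h x y = 0) → x = 0) :
    hh.radical ⊤ = ⊥ := by
  rw [eq_bot_iff]
  intro y hy
  exact hnd y fun z => (hh.mem_radical.1 hy).2 z trivial

lemma radical_perp_isotropic (hh : IsHermitianForm p h) (hnd : ∀ x, (∀ y, h x y = 0) → x = 0)
    {x : V} (hx : x ≠ 0) (hxx : h x x = 0) :
    hh.radical (hh.perp ⊤ x) = Submodule.span (GaloisField p 2) {x} := by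
  have : Fintype (GaloisField p 2) := Fintype.ofFinite _
  apply le_antisymm
  · intro y hy
    obtain ⟨z₀, hz₀⟩ := hh.exists_ne_zero hnd hx
    obtain ⟨-, hy'⟩ := hh.mem_radical.1 hy
    set c := h z₀ y / h z₀ x with hc
    have hcp : (c ^ p) ^ p = c := by
      rw [← pow_mul, ← sq, ← GaloisField.card p 2 two_ne_zero, Nat.card_eq_fintype_card,
        FiniteField.pow_card]
    have h1 : y - c ^ p • x = 0 := by
      refine hnd _ fun z => hh.eq_zero_comm.1 ?_
      have h2 : h (z - (h z x / h z₀ x) • z₀) y = 0 := by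
        refine hh.eq_zero_comm.1 (hy' _ (hh.mem_perp.2 ⟨trivial, ?_⟩))
        rw [← hh.left_apply, map_sub, map_smul, hh.left_apply, hh.left_apply, smul_eq_mul,
          div_mul_cancel₀ _ hz₀, sub_self]
      rw [← hh.left_apply, map_sub, map_smul, hh.left_apply, hh.left_apply, smul_eq_mul] at h2
      rw [sub_eq_add_neg, ← neg_smul, hh.add_right, hh.smul_right, neg_eq_neg_one_mul, mul_pow,
        neg_one_pow_char, hcp, hc, ← h2]
      ring
    rw [sub_eq_zero.1 h1]
    exact Submodule.smul_mem _ _ (Submodule.mem_span_singleton_self x)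
  · rw [Submodule.span_singleton_le_iff_mem, mem_radical, mem_perp]
    exact ⟨⟨trivial, hxx⟩, fun z hz => hh.eq_zero_comm.1 (hh.mem_perp.1 hz).2⟩

lemma finrank_span_pair {x y : V} (hx : x ≠ 0) (hy : y ∉ Submodule.span (GaloisField p 2) {x}) :
    Module.finrank (GaloisField p 2) (Submodule.span (GaloisField p 2) {x, y}) = 2 := by
  have hli : LinearIndependent (GaloisField p 2) ![x, y] :=
    (LinearIndependent.pair_iff' hx).2 fun a ha => hy (Submodule.mem_span_singleton.2 ⟨a, ha⟩)
  have := finrank_span_eq_card hli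
  rwa [Matrix.range_cons_cons_empty, Fintype.card_fin] at this

/-- Two independent orthogonal isotropic vectors of a nondegenerate 4-dimensional Hermitian
space span a Lagrangian plane. -/
lemma mem_span_pair_iff [FiniteDimensional (GaloisField p 2) V] (hh : IsHermitianForm p h)
    (hnd : ∀ x, (∀ y, h x y = 0) → x = 0)
    (hV : Module.finrank (GaloisField p 2) V = 4) {x y : V} (hx : x ≠ 0) (hxx : h x x = 0)
    (hyy : h y y = 0) (hxy : h x y = 0) (hy : y ∉ Submodule.span (GaloisField p 2) {x}) (z : V) :
    z ∈ Submodule.span (GaloisField p 2) {x, y} ↔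
      ∀ w ∈ Submodule.span (GaloisField p 2) {x, y}, h w z = 0 := by
  have hyx := hh.eq_zero_comm.1 hxy
  have hspan : Submodule.span (GaloisField p 2) {x, y} = hh.perp (hh.perp ⊤ x) y := by
    refine Submodule.eq_of_le_of_finrank_eq ?_ ?_
    · rw [Submodule.span_le]
      rintro w (rfl | rfl) <;> simp [mem_perp, *]
    · rw [finrank_span_pair hx hy]
      obtain ⟨z₁, hz₁⟩ := hh.exists_ne_zero hnd hx
      have h1 := hh.finrank_perp (W := ⊤) trivial hz₁
      rw [finrank_top, hV] at h1
      obtain ⟨z₂, hz₂, hz₂'⟩ : ∃ z ∈ hh.perp ⊤ x, h z y ≠ 0 := by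
        by_contra! hall
        apply hy
        rw [← hh.radical_perp_isotropic hnd hx hxx, mem_radical, mem_perp]
        exact ⟨⟨trivial, hyx⟩, fun z hz => hh.eq_zero_comm.1 (hall z hz)⟩
      have h2 := hh.finrank_perp hz₂ hz₂'
      omega
  constructor
  · intro hz w hw
    rw [hspan, mem_perp, mem_perp] at hz
    have hle : Submodule.span (GaloisField p 2) {x, y} ≤ LinearMap.ker (hh.left z) := by
      rw [Submodule.span_le]
      rintro w (rfl | rfl)
      · simpa using hh.eq_zero_comm.1 hz.1.2
      · simpa using hh.eq_zero_comm.1 hz.2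
    simpa using hle hw
  · intro hz
    rw [hspan, mem_perp, mem_perp]
    exact ⟨⟨trivial, hh.eq_zero_comm.1 (hz x (Submodule.subset_span (by simp)))⟩,
      hh.eq_zero_comm.1 (hz y (Submodule.subset_span (by simp)))⟩

variable [Fintype V]

open Classical in
/-- The number of isotropic vectors of `W`, the zero vector included. -/
noncomputable def isotropicCard (h : V → V → GaloisField p 2) (W : Submodule (GaloisField p 2) V) :
    ℕ := (Finset.univ.filter fun x => x ∈ W ∧ h x x = 0).card

lemma card_mem_submodule (W : Submodule (GaloisField p 2) V) [DecidablePred (· ∈ W)] :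
    (Finset.univ.filter fun x => x ∈ W).card =
      (p ^ 2) ^ Module.finrank (GaloisField p 2) W := by
  rw [← GaloisField.card p 2 two_ne_zero, ← Module.natCard_eq_pow_finrank, ← Fintype.card_subtype,
    Nat.card_eq_fintype_card]

lemma isotropicCard_add (hh : IsHermitianForm p h) {W : Submodule (GaloisField p 2) V} {x : V}
    (hx : x ∈ W) (hxx : h x x ≠ 0) :
    isotropicCard h W + p * isotropicCard h (hh.perp W x) =
      (p + 1) * (p ^ 2) ^ Module.finrank (GaloisField p 2) (hh.perp W x) := by
  classical
  have : Fintype (GaloisField p 2) := Fintype.ofFinite _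
  have h1 : isotropicCard h W =
      ∑ y with y ∈ hh.perp W x,
        (Finset.univ.filter fun t : GaloisField p 2 => t ^ (p + 1) * h x x + h y y = 0).card := by
    have hval : ∀ y ∈ hh.perp W x, ∀ t : GaloisField p 2,
        h (t • x + y) (t • x + y) = t ^ (p + 1) * h x x + h y y := by
      intro y hy t
      have h2 := (hh.mem_perp.1 hy).2
      have h3 := hh.eq_zero_comm.1 h2
      rw [hh.1, hh.add_right, hh.add_right, hh.2.1, hh.2.1, hh.smul_right, hh.smul_right, h2, h3]
      ring
    rw [← Finset.card_sigma, isotropicCard]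
    refine Finset.card_nbij' (fun z => ⟨z - (h z x / h x x) • x, h z x / h x x⟩)
      (fun q => q.2 • x + q.1) ?_ ?_ ?_ ?_
    · intro z hz
      simp only [Finset.coe_filter, Finset.mem_univ, true_and, Set.mem_ofPred_eq] at hz
      have h4 := hh.sub_smul_mem_perp hx hxx hz.1
      simp only [Finset.coe_sigma, Set.mem_sigma_iff, Finset.mem_coe, Finset.mem_filter,
        Finset.mem_univ, true_and]
      refine ⟨h4, ?_⟩
      rw [← hval _ h4, add_sub_cancel, hz.2]
    · rintro ⟨y, t⟩ hq
      simp only [Finset.coe_sigma, Set.mem_sigma_iff, Finset.mem_coe, Finset.mem_filter,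
        Finset.mem_univ, true_and] at hq
      simp only [Finset.coe_filter, Finset.mem_univ, true_and, Set.mem_ofPred_eq]
      exact ⟨W.add_mem (W.smul_mem _ hx) (hh.mem_perp.1 hq.1).1, by rw [hval _ hq.1, hq.2]⟩
    · intro z _
      simp
    · rintro ⟨y, t⟩ hq
      simp only [Finset.coe_sigma, Set.mem_sigma_iff, Finset.mem_coe, Finset.mem_filter,
        Finset.mem_univ, true_and] at hq
      have h5 : h (t • x + y) x / h x x = t := by
        rw [hh.1, hh.2.1, (hh.mem_perp.1 hq.1).2, add_zero, mul_div_cancel_right₀ _ hxx]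
      simp only [h5, add_sub_cancel_left]
  have h2 : ∀ y, (Finset.univ.filter
      fun t : GaloisField p 2 => t ^ (p + 1) * h x x + h y y = 0).card +
        p * (if h y y = 0 then 1 else 0) = p + 1 := by
    intro y
    split_ifs with hy
    · rw [mul_one, add_comm, add_right_inj, Finset.card_eq_one]
      exact ⟨0, by ext; simp [hy, hxx]⟩
    · rw [mul_zero, add_zero]
      have hne : -h y y / h x x ≠ 0 := div_ne_zero (neg_ne_zero.2 hy) hxx
      have hfix : (-h y y / h x x) ^ p = -h y y / h x x := by
        rw [div_pow, ← hh.2.2, neg_eq_neg_one_mul, mul_pow, ← hh.2.2, ← neg_eq_neg_one_mul]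
        congr 1
        rw [neg_one_pow_char, neg_one_mul]
      refine Eq.trans (congrArg Finset.card ?_) (GaloisField.card_norm_fiber hne hfix)
      ext t
      simp only [Finset.mem_filter, Finset.mem_univ, true_and]
      rw [eq_div_iff hxx, add_eq_zero_iff_eq_neg]
  have h3 : isotropicCard h (hh.perp W x) =
      ∑ y with y ∈ hh.perp W x, if h y y = 0 then 1 else 0 := by
    rw [isotropicCard, ← Finset.filter_filter, Finset.card_filter]
  rw [h1, h3, Finset.mul_sum, ← Finset.sum_add_distrib, Finset.sum_congr rfl (fun y _ => h2 y),
    Finset.sum_const, card_mem_submodule, smul_eq_mul, mul_comm]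

/-- The number of isotropic vectors of a Hermitian space in terms of its dimension and the
dimension of its radical. -/
theorem mul_isotropicCard (hh : IsHermitianForm p h) (W : Submodule (GaloisField p 2) V)
    {n r : ℕ} (hn : Module.finrank (GaloisField p 2) W = n)
    (hr : Module.finrank (GaloisField p 2) (hh.radical W) = r) :
    (p * isotropicCard h W : ℤ) = p ^ (2 * n) + (-1) ^ (n + r) * (p - 1) * p ^ (n + r) := by
  classical
  have hdiag : ∀ (W : Submodule (GaloisField p 2) V) (n : ℕ),
      Module.finrank (GaloisField p 2) W = n →
      Module.finrank (GaloisField p 2) (hh.radical W) = r → (∀ x ∈ W, h x x = 0) →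
      (p * isotropicCard h W : ℤ) =
        p ^ (2 * n) + (-1) ^ (n + r) * (p - 1) * p ^ (n + r) := by
    intro W n hn hr hW
    obtain rfl : n = r := by rw [← hn, ← hr, hh.radical_eq_self hW]
    have h1 : isotropicCard h W = (p ^ 2) ^ n := by
      rw [← hn, ← card_mem_submodule, isotropicCard]
      congr 1
      ext x
      simpa using hW x
    rw [h1, (Even.add_self n).neg_one_pow, ← two_mul]
    push_cast
    ring
  induction n generalizing W with
  | zero =>
    refine hdiag W 0 hn hr fun x hx => ?_
    rw [Submodule.finrank_eq_zero.1 hn, Submodule.mem_bot] at hx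
    rw [hx, hh.zero_left]
  | succ n ih =>
    by_cases hW : ∀ x ∈ W, h x x = 0
    · exact hdiag W (n + 1) hn hr hW
    · push Not at hW
      obtain ⟨x, hx, hxx⟩ := hW
      have h1 : Module.finrank (GaloisField p 2) (hh.perp W x) = n := by
        have := hh.finrank_perp hx hxx
        omega
      have h2 := ih (hh.perp W x) h1 (by rw [hh.radical_perp hx hxx, hr])
      have h3 := hh.isotropicCard_add hx hxx
      rw [h1] at h3
      have h4 : (isotropicCard h W + p * isotropicCard h (hh.perp W x) : ℤ) =
        (p + 1) * (p ^ 2) ^ n := by exact_mod_cast h3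
      rw [h2] at h4
      rw [eq_sub_of_add_eq h4]
      ring

lemma card_and_notMem (P : V → Prop) [DecidablePred P] (W : Submodule (GaloisField p 2) V)
    [DecidablePred (· ∈ W)] (hW : ∀ y ∈ W, P y) :
    (Finset.univ.filter fun y => P y ∧ y ∉ W).card +
      (p ^ 2) ^ Module.finrank (GaloisField p 2) W = (Finset.univ.filter P).card := by
  rw [← card_mem_submodule, ← Finset.card_filter_add_card_filter_not (s := Finset.univ.filter P)
    (fun y => y ∈ W), add_comm, Finset.filter_filter, Finset.filter_filter]
  congr 2
  ext y
  simpa using hW y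

/-- The number of Lagrangian planes of a nondegenerate 4-dimensional Hermitian space. -/
theorem card_lagrangian (hh : IsHermitianForm p h) (hnd : ∀ x, (∀ y, h x y = 0) → x = 0)
    (hV : Module.finrank (GaloisField p 2) V = 4) :
    {U : Submodule (GaloisField p 2) V | Module.finrank (GaloisField p 2) U = 2 ∧
      ∀ y, (y ∈ U ↔ ∀ x ∈ U, h x y = 0)}.ncard = (p ^ 3 + 1) * (p + 1) := by
  classical
  have : Fintype (Submodule (GaloisField p 2) V) := Fintype.ofFinite _
  rw [Set.ncard_eq_toFinset_card', Set.toFinset_ofPred]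
  set S := Finset.univ.filter fun U : Submodule (GaloisField p 2) V =>
    Module.finrank (GaloisField p 2) U = 2 ∧ ∀ y, (y ∈ U ↔ ∀ x ∈ U, h x y = 0) with hS
  set P := Finset.univ.filter fun q : V × V =>
    (h q.1 q.1 = 0 ∧ q.1 ∉ (⊥ : Submodule (GaloisField p 2) V)) ∧
    ((q.2 ∈ hh.perp ⊤ q.1 ∧ h q.2 q.2 = 0) ∧ q.2 ∉ Submodule.span (GaloisField p 2) {q.1})
    with hP
  have hspan1 : ∀ x : V, x ∉ (⊥ : Submodule (GaloisField p 2) V) →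
      Module.finrank (GaloisField p 2) (Submodule.span (GaloisField p 2) {x}) = 1 :=
    fun x hx => finrank_span_singleton (by simpa using hx)
  obtain ⟨a, ha⟩ : ∃ a, a = (Finset.univ.filter
    fun x : V => h x x = 0 ∧ x ∉ (⊥ : Submodule (GaloisField p 2) V)).card := ⟨_, rfl⟩
  have ha1 : (p * (a + 1) : ℤ) = p ^ 8 + (p - 1) * p ^ 4 := by
    have h1 := card_and_notMem (p := p) (fun x : V => h x x = 0) ⊥
      (by rintro y rfl; exact hh.zero_left 0)
    have h2 := hh.mul_isotropicCard ⊤ (n := 4) (r := 0) (by rw [finrank_top, hV])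
      (by rw [hh.radical_top hnd, finrank_bot])
    simp only [isotropicCard, Submodule.mem_top, true_and] at h2
    rw [← ha, finrank_bot, pow_zero] at h1
    rw [← h1] at h2
    push_cast at h2
    rw [h2]
    ring
  have hm : ∃ m : ℕ, (p * (m + p ^ 2) : ℤ) = p ^ 6 + (p - 1) * p ^ 4 ∧
      P.card = a * m := by
    have key : ∀ x : V, (h x x = 0 ∧ x ∉ (⊥ : Submodule (GaloisField p 2) V)) →
        (p * ((Finset.univ.filter fun y : V => (y ∈ hh.perp ⊤ x ∧ h y y = 0) ∧
          y ∉ Submodule.span (GaloisField p 2) {x}).card + p ^ 2) : ℤ) =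
            p ^ 6 + (p - 1) * p ^ 4 := by
      rintro x ⟨hxx, hx⟩
      have hx0 : x ≠ 0 := by simpa using hx
      have h1 := card_and_notMem (p := p) (fun y : V => y ∈ hh.perp ⊤ x ∧ h y y = 0)
        (Submodule.span (GaloisField p 2) {x}) (by
          intro y hy
          obtain ⟨t, rfl⟩ := Submodule.mem_span_singleton.1 hy
          simp [mem_perp, hh.2.1, hh.smul_right, hxx])
      obtain ⟨z, hz⟩ := hh.exists_ne_zero hnd hx0
      have h3 := hh.finrank_perp (W := ⊤) trivial hz
      rw [finrank_top, hV] at h3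
      have h2 := hh.mul_isotropicCard (hh.perp ⊤ x) (n := 3) (r := 1) (by omega)
        (by rw [hh.radical_perp_isotropic hnd hx0 hxx, hspan1 x hx])
      rw [hspan1 x hx, pow_one] at h1
      rw [isotropicCard, ← h1] at h2
      push_cast at h2
      rw [h2]
      ring
    have hp : (p : ℤ) ≠ 0 := by exact_mod_cast (Fact.out : p.Prime).ne_zero
    by_cases hex : ∃ x : V, h x x = 0 ∧ x ∉ (⊥ : Submodule (GaloisField p 2) V)
    · obtain ⟨x₀, hx₀⟩ := hex
      refine ⟨_, key x₀ hx₀, ?_⟩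
      rw [ha, hP]
      refine Finset.card_filter_prod_of_forall
        (fun x => h x x = 0 ∧ x ∉ (⊥ : Submodule (GaloisField p 2) V))
        (fun x y => (y ∈ hh.perp ⊤ x ∧ h y y = 0) ∧
          y ∉ Submodule.span (GaloisField p 2) {x}) _ fun x hx => ?_
      have := mul_left_cancel₀ hp ((key x hx).trans (key x₀ hx₀).symm)
      exact_mod_cast add_right_cancel this
    · exfalso
      have h0 : a = 0 := by
        rw [ha, Finset.card_eq_zero, Finset.filter_eq_empty_iff]
        exact fun x _ hx => hex ⟨x, hx⟩
      have hp2 : (2 : ℤ) ≤ p := by exact_mod_cast (Fact.out : p.Prime).two_le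
      have h4 : (p : ℤ) < p ^ 8 := lt_self_pow₀ (by linarith) (by norm_num)
      have h5 : (0 : ℤ) ≤ (p - 1) * p ^ 4 := mul_nonneg (by linarith) (by positivity)
      rw [h0] at ha1
      push_cast at ha1
      linarith
  obtain ⟨m, hm1, hPm⟩ := hm
  have hfib : ∀ U ∈ S, (P.filter fun q => Submodule.span (GaloisField p 2) {q.1, q.2} = U).card =
      ((p ^ 2) ^ 2 - 1) * ((p ^ 2) ^ 2 - p ^ 2) := by
    intro U hU
    obtain ⟨hU2, hUU⟩ := (Finset.mem_filter.1 hU).2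
    have h1 := card_and_notMem (p := p) (fun y : V => y ∈ U) ⊥ (by simp)
    rw [card_mem_submodule, hU2, finrank_bot, pow_zero] at h1
    rw [← Nat.eq_sub_of_add_eq h1]
    rw [← Finset.card_filter_prod_of_forall _
      (fun x y => y ∈ U ∧ y ∉ Submodule.span (GaloisField p 2) {x})]
    · congr 1
      ext ⟨x, y⟩
      simp only [hP, Finset.mem_filter, Finset.mem_univ, true_and]
      constructor
      · rintro ⟨⟨⟨-, hx⟩, -, hy⟩, rfl⟩
        exact ⟨⟨Submodule.subset_span (by simp), hx⟩, Submodule.subset_span (by simp), hy⟩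
      · rintro ⟨⟨hxU, hx⟩, hyU, hy⟩
        refine ⟨⟨⟨(hUU x).1 hxU x hxU, hx⟩, ⟨hh.mem_perp.2 ⟨trivial, (hUU x).1 hxU y hyU⟩,
          (hUU y).1 hyU y hyU⟩, hy⟩, Submodule.eq_of_le_of_finrank_eq ?_ ?_⟩
        · rw [Submodule.span_le]
          rintro w (rfl | rfl) <;> assumption
        · rw [hU2, finrank_span_pair (by simpa using hx) hy]
    · rintro x ⟨hxU, hx⟩
      have h2 := card_and_notMem (p := p) (fun y : V => y ∈ U)
        (Submodule.span (GaloisField p 2) {x}) (fun y hy =>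
          (Submodule.span_singleton_le_iff_mem x U).2 hxU hy)
      rw [card_mem_submodule, hU2, hspan1 x hx, pow_one] at h2
      exact Nat.eq_sub_of_add_eq h2
  have hmaps : ∀ q ∈ P, Submodule.span (GaloisField p 2) {q.1, q.2} ∈ S := by
    rintro ⟨x, y⟩ hq
    obtain ⟨⟨hxx, hx⟩, ⟨hxy, hyy⟩, hy⟩ := (Finset.mem_filter.1 hq).2
    have hx0 : x ≠ 0 := by simpa using hx
    exact Finset.mem_filter.2 ⟨Finset.mem_univ _, finrank_span_pair hx0 hy,
      hh.mem_span_pair_iff hnd hV hx0 hxx hyy (hh.eq_zero_comm.1 (hh.mem_perp.1 hxy).2) hy⟩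
  have hcount := Finset.card_eq_sum_card_fiberwise hmaps
  rw [Finset.sum_const_nat hfib, hPm] at hcount
  have hp2 : 2 ≤ p := (Fact.out : p.Prime).two_le
  have hQ : p ^ 2 ≤ (p ^ 2) ^ 2 := Nat.le_self_pow two_ne_zero _
  have hQ1 : 1 < p ^ 2 := Nat.one_lt_pow two_ne_zero (by omega)
  have hcountZ : (a * m : ℤ) = S.card * (((p ^ 2) ^ 2 - 1) * ((p ^ 2) ^ 2 - p ^ 2)) := by
    zify [hQ, hQ1.le.trans hQ] at hcount
    exact hcount
  have hQZ : (1 : ℤ) < p ^ 2 := by exact_mod_cast hQ1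
  have hne : ((p : ℤ) ^ 2 * (((p ^ 2) ^ 2 - 1) * ((p ^ 2) ^ 2 - p ^ 2))) ≠ 0 := by
    have h1 : (0 : ℤ) < (p ^ 2) ^ 2 - 1 := by nlinarith
    have h2 : (0 : ℤ) < (p ^ 2) ^ 2 - p ^ 2 := by nlinarith
    positivity
  have hfinal : (S.card : ℤ) = (p ^ 3 + 1) * (p + 1) := by
    apply mul_right_cancel₀ hne
    have h1 : (p * a : ℤ) = p ^ 8 + (p - 1) * p ^ 4 - p := by linarith
    have h2 : (p * m : ℤ) = p ^ 6 + (p - 1) * p ^ 4 - p ^ 3 := by linarith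
    calc (S.card : ℤ) * (p ^ 2 * (((p ^ 2) ^ 2 - 1) * ((p ^ 2) ^ 2 - p ^ 2)))
        = (p * a) * (p * m) := by linear_combination -(p : ℤ) ^ 2 * hcountZ
      _ = _ := by rw [h1, h2]; ring
  exact_mod_cast hfinal

end IsHermitianForm

/-- The number of Lagrangian planes (2-dimensional subspaces `U` with `U = U^⊥`) in a
nondegenerate `4`-dimensional Hermitian space `𝔽_{p²}⁴` is `(p³+1)(p+1)`. -/
theorem stmt5 (p : ℕ) [Fact p.Prime]
    (h : (Fin 4 → GaloisField p 2) → (Fin 4 → GaloisField p 2) → GaloisField p 2)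
    (hherm : IsHermitianForm p h)
    (hnd : ∀ x, (∀ y, h x y = 0) → x = 0) :
    {U : Submodule (GaloisField p 2) (Fin 4 → GaloisField p 2) |
        Module.finrank (GaloisField p 2) U = 2 ∧
        ∀ y, (y ∈ U ↔ ∀ x ∈ U, h x y = 0)}.ncard = (p ^ 3 + 1) * (p + 1) := by
  have : Fintype (Fin 4 → GaloisField p 2) := Fintype.ofFinite _
  exact hherm.card_lagrangian hnd (by simp)
end

section
/- Let p be an odd prime and let V_0 be the 6-dimensional quadratic space over Q_p given as the orthogonal direct sum of two hyperbolic planes and (Q_{p^2}, Norm_{Q_{p^2}/Q_p}), where Q_{p^2} is the unramified quadratic extension of Q_p. Let L ⊆ V_0 be a Z_p-lattice satisfying L ⊆ L^* ⊆ p^{-1}L with dim_{F_p}(L^*/L) = 2, where L^* is the dual lattice. Then the F_p-quadratic space L^*/L (with the form induced by the quadratic form of V_0 reduced mod p) is a hyperbolic plane; in particular it contains exactly two isotropic lines. -/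
/-- The quadratic form of the `6`-dimensional `ℚ_p`-quadratic space
`V₀ = ℍ ⊕ ℍ ⊕ (ℚ_{p²}, Norm)`: two hyperbolic planes plus the norm form of the
unramified quadratic extension, realized (for `p` odd) as `x² - Δ·y²` with `Δ` a
nonsquare unit. -/
noncomputable def vForm (p : ℕ) [Fact p.Prime] (Δ : ℚ_[p])
    (v : (Fin 2 → ℚ_[p] × ℚ_[p]) × (ℚ_[p] × ℚ_[p])) : ℚ_[p] :=
  (∑ i, (v.1 i).1 * (v.1 i).2) + (v.2.1 ^ 2 - Δ * v.2.2 ^ 2)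

theorem PadicInt.smul_eq_coe_smul {p : ℕ} [Fact p.Prime] {V : Type*} [AddCommGroup V]
    [Module ℚ_[p] V] [Module ℤ_[p] V] [IsScalarTower ℤ_[p] ℚ_[p] V] (a : ℤ_[p]) (x : V) :
    a • x = (a : ℚ_[p]) • x :=
  (algebraMap_smul ℚ_[p] a x).symm

theorem Padic.norm_two_of_odd {p : ℕ} [Fact p.Prime] (hodd : Odd p) : ‖(2 : ℚ_[p])‖ = 1 := by
  have h := Padic.norm_natCast_eq_one_iff (p := p) (n := 2)
  push_cast at h
  exact h.2 (Nat.coprime_two_right.2 hodd)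

/-- A `p`-adic number congruent to a unit square is a square. -/
theorem Padic.isSquare_of_norm_sq_sub_lt_one {p : ℕ} [Fact p.Prime] (hodd : Odd p)
    {t d : ℚ_[p]} (ht : ‖t‖ = 1) (hd : ‖d‖ ≤ 1) (h : ‖t ^ 2 - d‖ < 1) : IsSquare d := by
  obtain ⟨t, rfl⟩ : ∃ t' : ℤ_[p], (t' : ℚ_[p]) = t := ⟨⟨t, ht.le⟩, rfl⟩
  obtain ⟨d, rfl⟩ : ∃ d' : ℤ_[p], (d' : ℚ_[p]) = d := ⟨⟨d, hd⟩, rfl⟩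
  have hval : (Polynomial.X ^ 2 - Polynomial.C d).aeval t = t ^ 2 - d := by simp
  have hder : (Polynomial.derivative (Polynomial.X ^ 2 - Polynomial.C d)).aeval t = 2 * t := by
    simp [one_add_one_eq_two]
  have hder' : ‖2 * t‖ = 1 := by
    rw [PadicInt.norm_def, PadicInt.coe_mul, norm_mul, ht, mul_one]
    exact Padic.norm_two_of_odd hodd
  obtain ⟨z, hz, -⟩ := hensels_lemma (F := Polynomial.X ^ 2 - Polynomial.C d) (a := t) (by
    rw [hval, hder, hder', one_pow, PadicInt.norm_def]
    exact_mod_cast h)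
  refine ⟨z, ?_⟩
  have hz' : z ^ 2 = d := by simpa [sub_eq_zero] using hz
  rw [← hz', sq, PadicInt.coe_mul]

/-- The norm form of the unramified quadratic extension is anisotropic modulo `p`. -/
theorem Padic.norm_sq_sub_mul_sq {p : ℕ} [Fact p.Prime] (hodd : Odd p)
    {Δ : ℚ_[p]} (hΔunit : ‖Δ‖ = 1) (hΔns : ¬ IsSquare Δ) (a b : ℚ_[p]) :
    ‖a ^ 2 - Δ * b ^ 2‖ = max (‖a‖ ^ 2) (‖b‖ ^ 2) := by
  have hb : ‖Δ * b ^ 2‖ = ‖b‖ ^ 2 := by rw [norm_mul, norm_pow, hΔunit, one_mul]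
  rcases eq_or_ne ‖a‖ ‖b‖ with hab | hab
  · rcases eq_or_ne b 0 with rfl | hb0
    · simp_all
    rw [hab, max_self]
    have ht : ‖a / b‖ = 1 := by rw [norm_div, hab, div_self (norm_ne_zero_iff.2 hb0)]
    have hle : ‖(a / b) ^ 2 - Δ‖ ≤ 1 := by
      rw [sub_eq_add_neg]
      refine (IsUltrametricDist.norm_add_le_max _ _).trans ?_
      rw [norm_neg, norm_pow, ht, hΔunit]
      simp
    have h1 : ‖(a / b) ^ 2 - Δ‖ = 1 := le_antisymm hle <| not_lt.1 fun hlt =>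
      hΔns (Padic.isSquare_of_norm_sq_sub_lt_one hodd ht hΔunit.le hlt)
    have : a ^ 2 - Δ * b ^ 2 = ((a / b) ^ 2 - Δ) * b ^ 2 := by field_simp
    rw [this, norm_mul, h1, one_mul, norm_pow]
  · have hne : ‖a ^ 2‖ ≠ ‖Δ * b ^ 2‖ := by
      rw [hb, norm_pow]
      exact fun h => hab ((pow_left_inj₀ (norm_nonneg _) (norm_nonneg _) two_ne_zero).1 h)
    rw [sub_eq_add_neg, IsUltrametricDist.norm_add_eq_max_of_norm_ne_norm (by rwa [norm_neg]),
      norm_neg, hb, norm_pow]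

theorem Padic.norm_le_one_of_sq_le {p : ℕ} [hp : Fact p.Prime] {a : ℚ_[p]}
    (h : ‖a‖ ^ 2 ≤ p) : ‖a‖ ≤ 1 := by
  rcases eq_or_ne a 0 with rfl | ha
  · simp
  have hp1 : (1 : ℝ) < p := by exact_mod_cast hp.out.one_lt
  rw [Padic.norm_eq_zpow_neg_valuation ha] at h ⊢
  rw [← zpow_natCast, ← zpow_mul] at h
  nth_rewrite 2 [← zpow_one (p : ℝ)] at h
  rw [zpow_le_zpow_iff_right₀ hp1] at h
  refine zpow_le_one_of_nonpos₀ hp1.le ?_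
  push_cast at h
  omega

theorem sup_span_singleton_eq {p : ℕ} [Fact p.Prime] {V : Type*} [AddCommGroup V]
    [Module ℤ_[p] V] {L : Submodule ℤ_[p] V} {x e : V} {a : ℤ_[p]} (ha : ‖a‖ = 1) (h : x - a • e ∈ L) :
    L ⊔ Submodule.span ℤ_[p] {x} = L ⊔ Submodule.span ℤ_[p] {e} := by
  obtain ⟨u, rfl⟩ := PadicInt.isUnit_iff.2 ha
  apply le_antisymm <;> refine sup_le le_sup_left ?_ <;>
    rw [Submodule.span_singleton_le_iff_mem, Submodule.mem_sup]
  · exact ⟨_, h, _, Submodule.mem_span_singleton.2 ⟨_, rfl⟩, sub_add_cancel _ _⟩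
  · refine ⟨_, L.neg_mem (L.smul_mem (↑u⁻¹ : ℤ_[p]) h), _,
      Submodule.mem_span_singleton.2 ⟨(↑u⁻¹ : ℤ_[p]), rfl⟩, ?_⟩
    rw [smul_sub, smul_smul, Units.inv_mul, one_smul]
    abel

section Lattice

variable {p : ℕ} [Fact p.Prime] {V : Type*} [AddCommGroup V] [Module ℚ_[p] V] [Module ℤ_[p] V]
  [IsScalarTower ℤ_[p] ℚ_[p] V] {B : LinearMap.BilinForm ℚ_[p] V} {L D : Submodule ℤ_[p] V}

theorem smul_mem_of_norm_lt_one (hpL : ∀ x ∈ D, (p : ℚ_[p]) • x ∈ L) {x : V} (hx : x ∈ D)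
    {a : ℤ_[p]} (ha : ‖a‖ < 1) : a • x ∈ L := by
  obtain ⟨c, rfl⟩ := (PadicInt.norm_lt_one_iff_dvd a).1 ha
  rw [mul_comm, mul_smul]
  refine L.smul_mem _ ?_
  simpa [PadicInt.smul_eq_coe_smul] using hpL x hx

theorem norm_lt_one_of_mul_mem {a : ℤ_[p]} {c : ℚ_[p]} (hc : c ∉ PadicInt.subring p)
    (h : (a : ℚ_[p]) * c ∈ PadicInt.subring p) : ‖a‖ < 1 := by
  refine lt_of_le_of_ne (PadicInt.norm_le_one a) fun h1 => hc ?_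
  rw [PadicInt.mem_subring_iff] at h ⊢
  rwa [norm_mul, ← PadicInt.norm_def, h1, one_mul] at h

/-- The classes of `e` and `f` in `D / L` are linearly independent modulo `p`. -/
theorem norm_lt_one_of_smul_add_smul_mem (hB : B.IsSymm)
    (hD : ∀ x, x ∈ D ↔ ∀ l ∈ L, B x l ∈ PadicInt.subring p)
    {e f : V} (he : e ∈ D) (hf : f ∈ D) (hee : B e e ∈ PadicInt.subring p)
    (hff : B f f ∈ PadicInt.subring p) (hef : B e f ∉ PadicInt.subring p)
    {a b : ℤ_[p]} (h : a • e + b • f ∈ L) : ‖a‖ < 1 ∧ ‖b‖ < 1 := by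
  have h1 := (hD e).1 he _ h
  have h2 := (hD f).1 hf _ h
  simp only [PadicInt.smul_eq_coe_smul, map_add, map_smul, smul_eq_mul] at h1 h2
  rw [hB.eq f e] at h2
  constructor
  · refine norm_lt_one_of_mul_mem hef ?_
    simpa using sub_mem h2 (mul_mem b.2 hff)
  · refine norm_lt_one_of_mul_mem hef ?_
    simpa using sub_mem h1 (mul_mem a.2 hee)

theorem dual_eq_sup_span_pair (hB : B.IsSymm) (hLD : L ≤ D)
    (hD : ∀ x, x ∈ D ↔ ∀ l ∈ L, B x l ∈ PadicInt.subring p)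
    (hindex : Nat.card (D ⧸ L.comap D.subtype) = p ^ 2)
    {e f : V} (he : e ∈ D) (hf : f ∈ D) (hee : B e e ∈ PadicInt.subring p)
    (hff : B f f ∈ PadicInt.subring p) (hef : B e f ∉ PadicInt.subring p) :
    D = L ⊔ Submodule.span ℤ_[p] {e, f} := by
  have hp : p.Prime := Fact.out
  have hfin : Finite (D ⧸ L.comap D.subtype) :=
    Nat.finite_of_card_ne_zero (by rw [hindex]; exact pow_ne_zero _ hp.ne_zero)
  let φ : Fin p × Fin p → D ⧸ L.comap D.subtype := fun ij =>
    Submodule.Quotient.mk (((ij.1 : ℕ) : ℤ_[p]) • ⟨e, he⟩ + ((ij.2 : ℕ) : ℤ_[p]) • ⟨f, hf⟩)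
  have eq_of_norm : ∀ i j : Fin p, ‖((i : ℕ) : ℤ_[p]) - ((j : ℕ) : ℤ_[p])‖ < 1 → i = j := by
    intro i j h
    have h' : ‖(((i : ℕ) - (j : ℕ) : ℤ) : ℤ_[p])‖ < 1 := by push_cast; exact h
    rw [PadicInt.norm_int_lt_one_iff_dvd] at h'
    have := Int.eq_zero_of_abs_lt_dvd h' (by rw [abs_lt]; constructor <;> omega)
    omega
  have hinj : Function.Injective φ := by
    rintro ⟨i, j⟩ ⟨i', j'⟩ h
    rw [Submodule.Quotient.eq] at h
    have h' : (((i : ℕ) : ℤ_[p]) - ((i' : ℕ) : ℤ_[p])) • e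
        + (((j : ℕ) : ℤ_[p]) - ((j' : ℕ) : ℤ_[p])) • f ∈ L := by
      convert (show _ ∈ L from h) using 1
      simp only [Submodule.subtype_apply, Submodule.coe_sub, Submodule.coe_add,
        Submodule.coe_smul]
      module
    obtain ⟨h1, h2⟩ := norm_lt_one_of_smul_add_smul_mem hB hD he hf hee hff hef h'
    rw [eq_of_norm _ _ h1, eq_of_norm _ _ h2]
  have hsurj : Function.Surjective φ :=
    (hinj.bijective_of_nat_card_le (by rw [hindex]; simp [sq])).2
  refine le_antisymm (fun z hz => ?_) (sup_le hLD (Submodule.span_le.2 ?_))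
  · obtain ⟨⟨i, j⟩, hij⟩ := hsurj (Submodule.Quotient.mk ⟨z, hz⟩)
    have h : z - (((i : ℕ) : ℤ_[p]) • e + ((j : ℕ) : ℤ_[p]) • f) ∈ L :=
      (Submodule.Quotient.eq (L.comap D.subtype)).1 hij.symm
    refine Submodule.mem_sup.2 ⟨_, h, _, ?_, sub_add_cancel _ _⟩
    exact Submodule.mem_span_pair.2 ⟨_, _, rfl⟩
  · rintro x (rfl | rfl) <;> assumption

theorem integral_of_mem_sup_span_singleton (hB : B.IsSymm) (hLD : L ≤ D)
    (hD : ∀ x, x ∈ D ↔ ∀ l ∈ L, B x l ∈ PadicInt.subring p)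
    {e : V} (he : e ∈ D) (hee : B e e ∈ PadicInt.subring p) {y : V}
    (hy : y ∈ L ⊔ Submodule.span ℤ_[p] {e}) : B y y ∈ PadicInt.subring p := by
  obtain ⟨l, hl, z, hz, rfl⟩ := Submodule.mem_sup.1 hy
  obtain ⟨c, rfl⟩ := Submodule.mem_span_singleton.1 hz
  have h1 := (hD e).1 he l hl
  have h2 := (hD l).1 (hLD hl) l hl
  have h3 := h1
  rw [hB.eq e l] at h3
  simp only [PadicInt.smul_eq_coe_smul, map_add, map_smul, LinearMap.add_apply,
    LinearMap.smul_apply, smul_eq_mul]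
  exact add_mem (add_mem h2 (mul_mem c.2 h1))
    (mul_mem c.2 (add_mem h3 (mul_mem c.2 hee)))

theorem ncard_isotropic_lines (hB : B.IsSymm) (h2 : ‖(2 : ℚ_[p])‖ = 1) (hLD : L ≤ D)
    (hpL : ∀ x ∈ D, (p : ℚ_[p]) • x ∈ L)
    (hD : ∀ x, x ∈ D ↔ ∀ l ∈ L, B x l ∈ PadicInt.subring p)
    {e f : V} (he : e ∈ D) (hf : f ∈ D) (hee : B e e ∈ PadicInt.subring p)
    (hff : B f f ∈ PadicInt.subring p) (hef : B e f ∉ PadicInt.subring p)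
    (hspan : D = L ⊔ Submodule.span ℤ_[p] {e, f}) :
    {M : Submodule ℤ_[p] V | (∃ x ∈ D, x ∉ L ∧ M = L ⊔ Submodule.span ℤ_[p] {x}) ∧
      ∀ y ∈ M, B y y ∈ PadicInt.subring p}.ncard = 2 := by
  have heL : e ∉ L := fun h => hef (by rw [← hB.eq f e]; exact (hD f).1 hf e h)
  have hfL : f ∉ L := fun h => hef ((hD e).1 he f h)
  have hne : L ⊔ Submodule.span ℤ_[p] {e} ≠ L ⊔ Submodule.span ℤ_[p] {f} := by
    intro h
    have hmem : e ∈ L ⊔ Submodule.span ℤ_[p] {f} :=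
      h ▸ Submodule.mem_sup_right (Submodule.mem_span_singleton_self e)
    obtain ⟨l, hl, z, hz, hlz⟩ := Submodule.mem_sup.1 hmem
    obtain ⟨c, rfl⟩ := Submodule.mem_span_singleton.1 hz
    have hl' : (1 : ℤ_[p]) • e + (-c) • f ∈ L := by
      convert hl using 1
      rw [← hlz]
      module
    have := (norm_lt_one_of_smul_add_smul_mem hB hD he hf hee hff hef hl').1
    simp at this
  rw [← Set.ncard_pair hne]
  congr 1
  ext M
  simp only [Set.mem_ofPred_eq, Set.mem_insert_iff, Set.mem_singleton_iff]
  constructor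
  · rintro ⟨⟨x, hx, hxL, rfl⟩, hM⟩
    have hxx := hM x (Submodule.mem_sup_right (Submodule.mem_span_singleton_self x))
    rw [hspan] at hx
    obtain ⟨l, hl, z, hz, rfl⟩ := Submodule.mem_sup.1 hx
    obtain ⟨a, b, rfl⟩ := Submodule.mem_span_pair.1 hz
    have hzD : a • e + b • f ∈ D := D.add_mem (D.smul_mem a he) (D.smul_mem b hf)
    have h1 := (hD _).1 hzD l hl
    have h1' := h1
    rw [hB.eq _ l] at h1'
    have hll := (hD l).1 (hLD hl) l hl
    have hzz : B (a • e + b • f) (a • e + b • f) ∈ PadicInt.subring p := by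
      have := sub_mem (sub_mem (sub_mem hxx hll) h1) h1'
      convert this using 1
      simp only [map_add, LinearMap.add_apply]
      ring
    have hab : ((a * b : ℤ_[p]) : ℚ_[p]) * B e f ∈ PadicInt.subring p := by
      have h3 : 2 * ((a * b : ℤ_[p]) * B e f) ∈ PadicInt.subring p := by
        convert sub_mem (sub_mem hzz (mul_mem a.2 (mul_mem a.2 hee)))
          (mul_mem b.2 (mul_mem b.2 hff)) using 1
        simp only [PadicInt.smul_eq_coe_smul, map_add, map_smul, LinearMap.add_apply,
          LinearMap.smul_apply, smul_eq_mul, hB.eq f e, PadicInt.coe_mul]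
        ring
      rw [PadicInt.mem_subring_iff, norm_mul, h2, one_mul] at h3
      exact h3
    have hab' := norm_lt_one_of_mul_mem hef hab
    rw [norm_mul] at hab'
    rcases (PadicInt.norm_le_one a).lt_or_eq with ha | ha
    · right
      have haL := smul_mem_of_norm_lt_one hpL he ha
      rcases (PadicInt.norm_le_one b).lt_or_eq with hb | hb
      · exact absurd (L.add_mem hl (L.add_mem haL (smul_mem_of_norm_lt_one hpL hf hb))) hxL
      · refine sup_span_singleton_eq hb ?_
        convert L.add_mem hl haL using 1
        abel
    · left
      rw [ha, one_mul] at hab'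
      refine sup_span_singleton_eq ha ?_
      convert L.add_mem hl (smul_mem_of_norm_lt_one hpL hf hab') using 1
      abel
  · rintro (rfl | rfl)
    · exact ⟨⟨e, he, heL, rfl⟩, fun y hy => integral_of_mem_sup_span_singleton hB hLD hD he hee hy⟩
    · exact ⟨⟨f, hf, hfL, rfl⟩, fun y hy => integral_of_mem_sup_span_singleton hB hLD hD hf hff hy⟩

/-- An isotropic vector of `D / L` extends to a hyperbolic pair. -/
theorem exists_hyperbolic_pair (hB : B.IsSymm) (h2 : ‖(2 : ℚ_[p])‖ = 1)
    (hpL : ∀ x ∈ D, (p : ℚ_[p]) • x ∈ L)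
    (hD : ∀ x, x ∈ D ↔ ∀ l ∈ L, B x l ∈ PadicInt.subring p)
    (hDD : ∀ x, (∀ y ∈ D, B x y ∈ PadicInt.subring p) → x ∈ L)
    {e : V} (he : e ∈ D) (heL : e ∉ L) (hee : B e e ∈ PadicInt.subring p) :
    ∃ f ∈ D, B f f ∈ PadicInt.subring p ∧ ‖(p : ℚ_[p]) * B e f - 1‖ < 1 := by
  obtain ⟨y, hy, hey⟩ : ∃ y ∈ D, B e y ∉ PadicInt.subring p := by
    by_contra! h
    exact heL (hDD e h)
  have hp0 : (p : ℚ_[p]) ≠ 0 := Nat.cast_ne_zero.2 (Fact.out : p.Prime).ne_zero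
  have hpey : (p : ℚ_[p]) * B e y ∈ PadicInt.subring p := by
    simpa using (hD e).1 he _ (hpL y hy)
  have hunit : ‖(show ℤ_[p] from ⟨_, hpey⟩)‖ = 1 := by
    refine le_antisymm (PadicInt.norm_le_one _) (not_lt.1 fun hlt => hey ?_)
    obtain ⟨c, hc⟩ := (PadicInt.norm_lt_one_iff_dvd _).1 hlt
    have hc' : (p : ℚ_[p]) * B e y = p * c := by
      simpa using congrArg (fun z : ℤ_[p] => (z : ℚ_[p])) hc
    rw [mul_left_cancel₀ hp0 hc']
    exact c.2
  obtain ⟨u, hu⟩ := PadicInt.isUnit_iff.2 hunit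
  obtain ⟨g, hg, heg⟩ : ∃ g ∈ D, (p : ℚ_[p]) * B e g = 1 := by
    refine ⟨(↑u⁻¹ : ℤ_[p]) • y, D.smul_mem _ hy, ?_⟩
    have h1 : ((↑u⁻¹ : ℤ_[p]) : ℚ_[p]) * (p * B e y) = 1 := by
      have := congrArg (fun z : ℤ_[p] => (z : ℚ_[p])) u.inv_mul
      rw [hu, PadicInt.coe_mul, PadicInt.coe_one] at this
      exact this
    rw [PadicInt.smul_eq_coe_smul, map_smul, smul_eq_mul, ← h1]
    ring
  have h2' : (2 : ℚ_[p])⁻¹ ∈ PadicInt.subring p := by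
    rw [PadicInt.mem_subring_iff, norm_inv, h2, inv_one]
  have hgg : (p : ℚ_[p]) * B g g ∈ PadicInt.subring p := by
    simpa using (hD g).1 hg _ (hpL g hg)
  have hk : (2 : ℚ_[p])⁻¹ * (p * B g g) ∈ PadicInt.subring p := mul_mem h2' hgg
  set k : ℤ_[p] := ⟨_, hk⟩
  have hkc : (k : ℚ_[p]) = 2⁻¹ * (p * B g g) := rfl
  refine ⟨g - k • e, D.sub_mem hg (D.smul_mem _ he), ?_, ?_⟩
  · have : B (g - k • e) (g - k • e) = k * (k * B e e) := by
      simp only [PadicInt.smul_eq_coe_smul, map_sub, map_smul, LinearMap.sub_apply,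
        LinearMap.smul_apply, smul_eq_mul, hB.eq g e]
      have : B e g = 1 / p := by rw [← heg]; field_simp
      rw [this, hkc]
      field_simp
      ring
    rw [this]
    exact mul_mem k.2 (mul_mem k.2 hee)
  · have : (p : ℚ_[p]) * B e (g - k • e) - 1 = p * -(k * B e e) := by
      simp only [PadicInt.smul_eq_coe_smul, map_sub, map_smul, smul_eq_mul]
      linear_combination heg
    rw [this, norm_mul]
    exact mul_lt_one_of_nonneg_of_lt_one_left (norm_nonneg _) Padic.norm_p_lt_one
      ((PadicInt.mem_subring_iff p).1 (neg_mem (mul_mem k.2 hee)))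

theorem exists_norm_le_of_fg (hFG : L.FG) (φ : V →ₗ[ℚ_[p]] ℚ_[p]) :
    ∃ l₀ ∈ L, ∀ l ∈ L, ‖φ l‖ ≤ ‖φ l₀‖ := by
  obtain ⟨S, rfl⟩ := hFG
  obtain ⟨l₀, hl₀, hmax⟩ := (insert 0 (S : Set V)).toFinite.exists_maximalFor
    (fun x => ‖φ x‖) _ (Set.insert_nonempty _ _)
  have hmax' : ∀ x ∈ (S : Set V), ‖φ x‖ ≤ ‖φ l₀‖ := fun x hx =>
    (le_total ‖φ x‖ ‖φ l₀‖).elim id fun h => hmax (Set.mem_insert_of_mem _ hx) h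
  refine ⟨l₀, ?_, fun l hl => ?_⟩
  · rcases hl₀ with rfl | h
    · exact zero_mem _
    · exact Submodule.subset_span h
  · induction hl using Submodule.span_induction with
    | mem x hx => exact hmax' x hx
    | zero => simp
    | add x y _ _ hx hy =>
      rw [map_add]
      exact (IsUltrametricDist.norm_add_le_max _ _).trans (max_le hx hy)
    | smul a x _ hx =>
      rw [PadicInt.smul_eq_coe_smul, map_smul, norm_smul, ← PadicInt.norm_def]
      exact (mul_le_of_le_one_left (norm_nonneg _) (PadicInt.norm_le_one a)).trans hx

/-- If `D / L` is anisotropic, an isotropic vector has a multiple in `L` that pairs to `1`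
with an element of `L`. -/
theorem exists_pairing_eq_one (hFG : L.FG) (hspan : Submodule.span ℚ_[p] (L : Set V) = ⊤)
    (hBn : B.Nondegenerate) (hD : ∀ x, x ∈ D ↔ ∀ l ∈ L, B x l ∈ PadicInt.subring p)
    (haniso : ∀ x ∈ D, B x x ∈ PadicInt.subring p → x ∈ L)
    {w : V} (hw : w ≠ 0) (hww : B w w = 0) :
    ∃ c : ℚ_[p], c ≠ 0 ∧ c • w ∈ L ∧ ∃ g ∈ L, B (c • w) g = 1 := by
  obtain ⟨g, hg, hmax⟩ := exists_norm_le_of_fg hFG (B w)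
  have hg0 : B w g ≠ 0 := by
    intro h0
    have hL : ∀ l ∈ L, B w l = 0 := fun l hl => by simpa [h0] using hmax l hl
    have : B w = 0 := LinearMap.ext_on hspan fun l hl => by simpa using hL l hl
    exact hw (hBn.1 w fun v => by rw [this]; rfl)
  refine ⟨(B w g)⁻¹, inv_ne_zero hg0, haniso _ ((hD _).2 fun l hl => ?_) ?_, g, hg, ?_⟩
  · rw [PadicInt.mem_subring_iff, map_smul, LinearMap.smul_apply, smul_eq_mul, norm_mul, norm_inv,
      inv_mul_le_one₀ (norm_pos_iff.2 hg0)]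
    exact hmax l hl
  · simp [hww]
  · simp [hg0]

theorem mem_of_pairing_dual_integral (hFG : L.FG)
    (hspan : Submodule.span ℚ_[p] (L : Set V) = ⊤) [FiniteDimensional ℚ_[p] V]
    (hBn : B.Nondegenerate) (hB : B.IsSymm)
    (hD : ∀ x, x ∈ D ↔ ∀ l ∈ L, B x l ∈ PadicInt.subring p)
    (x : V) (hx : ∀ y ∈ D, B x y ∈ PadicInt.subring p) : x ∈ L := by
  have hone : ∀ z : ℚ_[p], z ∈ (1 : Submodule ℤ_[p] ℚ_[p]) ↔ z ∈ PadicInt.subring p := fun z =>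
    Submodule.mem_one.trans ⟨fun ⟨a, ha⟩ => ha ▸ a.2, fun h => ⟨⟨z, h⟩, rfl⟩⟩
  have hdual : B.dualSubmodule L = D := by
    ext y
    simp only [LinearMap.BilinForm.mem_dualSubmodule, hone, hD]
  have : L.IsLattice ℚ_[p] := ⟨hFG, hspan⟩
  have : Module.Finite ℤ_[p] L := Module.Finite.iff_fg.2 hFG
  have : Module.Free ℤ_[p] L := Submodule.IsLattice.free (K := ℚ_[p]) L
  let b := (Module.Free.chooseBasis ℤ_[p] L).extendOfIsLattice ℚ_[p]
  have hb : Submodule.span ℤ_[p] (Set.range b) = L := by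
    have : (b : _ → V) = L.subtype ∘ Module.Free.chooseBasis ℤ_[p] L := by
      ext i
      simp [b, Module.Basis.extendOfIsLattice_apply]
    rw [this, Set.range_comp, Submodule.span_image, Module.Basis.span_eq,
      Submodule.map_subtype_top]
  have hLL := LinearMap.BilinForm.dualSubmodule_dualSubmodule_of_basis (R := ℤ_[p]) B hBn hB b
  rw [hb, hdual] at hLL
  rw [← hLL, LinearMap.BilinForm.mem_dualSubmodule]
  exact fun y hy => (hone _).2 (hx y hy)

/-- If `D / L` is anisotropic, every class of `D / L` has a representative orthogonal to a
given totally isotropic plane. -/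
theorem exists_sub_mem_orthogonal (hFG : L.FG)
    (hspan : Submodule.span ℚ_[p] (L : Set V) = ⊤) (hBn : B.Nondegenerate) (hB : B.IsSymm)
    (hLD : L ≤ D) (hD : ∀ x, x ∈ D ↔ ∀ l ∈ L, B x l ∈ PadicInt.subring p)
    (haniso : ∀ x ∈ D, B x x ∈ PadicInt.subring p → x ∈ L)
    {u v : V} (huv : LinearIndependent ℚ_[p] ![u, v]) (huu : B u u = 0) (hvv : B v v = 0)
    (huv0 : B u v = 0) {x : V} (hx : x ∈ D) :
    ∃ l ∈ L, B (x - l) u = 0 ∧ B (x - l) v = 0 := by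
  rw [LinearIndependent.pair_iff] at huv
  have hu : u ≠ 0 := by
    rintro rfl
    simpa using huv 1 0 (by simp)
  obtain ⟨a, ha, hau, f, hf, hauf⟩ := exists_pairing_eq_one hFG hspan hBn hD haniso hu huu
  have hw : v - B v f • a • u ≠ 0 := by
    intro h
    have := (huv (-(B v f * a)) 1 (by rw [← h]; module)).2
    simp at this
  have hww : B (v - B v f • a • u) (v - B v f • a • u) = 0 := by
    simp [hB.eq v u, huu, hvv, huv0]
  obtain ⟨b, hb, hbw, g, hg, hbwg⟩ := exists_pairing_eq_one hFG hspan hBn hD haniso hw hww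
  set e₁ := a • u with he₁
  set e₂ := b • (v - B v f • e₁) with he₂
  have he₂f : B e₂ f = 0 := by
    simp [he₂, hauf]
  have hxe₁ := (hD x).1 hx _ hau
  have hxe₂ := (hD x).1 hx _ hbw
  have heg := (hD e₁).1 (hLD hau) g hg
  refine ⟨B x e₂ • (g - B e₁ g • f) + B x e₁ • f, ?_, ?_⟩
  · have hsmul : ∀ c ∈ PadicInt.subring p, ∀ l ∈ L, c • l ∈ L := fun c hc l hl => by
      exact PadicInt.smul_eq_coe_smul (p := p) ⟨c, hc⟩ l ▸ L.smul_mem (⟨c, hc⟩ : ℤ_[p]) hl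
    exact L.add_mem (hsmul _ hxe₂ _ (L.sub_mem hg (hsmul _ heg _ hf))) (hsmul _ hxe₁ _ hf)
  set y := x - (B x e₂ • (g - B e₁ g • f) + B x e₁ • f) with hy
  have hye₁ : B y e₁ = 0 := by
    simp only [hy, map_sub, map_add, map_smul, LinearMap.sub_apply, LinearMap.add_apply,
      LinearMap.smul_apply, smul_eq_mul, ← hB.eq e₁ f, ← hB.eq e₁ g, hauf]
    ring
  have hye₂ : B y e₂ = 0 := by
    simp only [hy, map_sub, map_add, map_smul, LinearMap.sub_apply, LinearMap.add_apply,
      LinearMap.smul_apply, smul_eq_mul, ← hB.eq e₂ f, ← hB.eq e₂ g, he₂f, hbwg]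
    ring
  have hyu : B y u = 0 := by simpa [he₁, ha] using hye₁
  refine ⟨hyu, ?_⟩
  simpa [he₂, he₁, hb, hyu] using hye₂

end Lattice

/-- The polar form of `vForm`. -/
noncomputable def vBilin (p : ℕ) [Fact p.Prime] (Δ : ℚ_[p]) :
    LinearMap.BilinForm ℚ_[p] ((Fin 2 → ℚ_[p] × ℚ_[p]) × (ℚ_[p] × ℚ_[p])) :=
  LinearMap.mk₂ ℚ_[p]
    (fun v w => (∑ i, ((v.1 i).1 * (w.1 i).2 + (v.1 i).2 * (w.1 i).1)) +
      2 * (v.2.1 * w.2.1 - Δ * v.2.2 * w.2.2))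
    (by intros; simp [Fin.sum_univ_two]; ring) (by intros; simp [Fin.sum_univ_two]; ring)
    (by intros; simp [Fin.sum_univ_two]; ring) (by intros; simp [Fin.sum_univ_two]; ring)

section Form

variable {p : ℕ} [Fact p.Prime] {Δ : ℚ_[p]}

theorem vBilin_apply (v w : (Fin 2 → ℚ_[p] × ℚ_[p]) × (ℚ_[p] × ℚ_[p])) :
    vBilin p Δ v w = (v.1 0).1 * (w.1 0).2 + (v.1 0).2 * (w.1 0).1 +
      ((v.1 1).1 * (w.1 1).2 + (v.1 1).2 * (w.1 1).1) +
      2 * (v.2.1 * w.2.1 - Δ * v.2.2 * w.2.2) := by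
  simp [vBilin, Fin.sum_univ_two]

theorem vBilin_eq_polar (v w : (Fin 2 → ℚ_[p] × ℚ_[p]) × (ℚ_[p] × ℚ_[p])) :
    vForm p Δ (v + w) - vForm p Δ v - vForm p Δ w = vBilin p Δ v w := by
  simp [vBilin_apply, vForm, Fin.sum_univ_two]
  ring

theorem vBilin_self (v : (Fin 2 → ℚ_[p] × ℚ_[p]) × (ℚ_[p] × ℚ_[p])) :
    vBilin p Δ v v = 2 * vForm p Δ v := by
  simp [vBilin_apply, vForm, Fin.sum_univ_two]
  ring

theorem vBilin_isSymm : (vBilin p Δ).IsSymm :=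
  ⟨fun v w => by simp only [vBilin_apply]; ring⟩

theorem vBilin_nondegenerate (hΔ : Δ ≠ 0) : (vBilin p Δ).Nondegenerate := by
  refine vBilin_isSymm.isRefl.nondegenerate_iff_separatingLeft.2 ?_
  intro v h
  have h1 := h (Pi.single 0 (1, 0), 0)
  have h2 := h (Pi.single 0 (0, 1), 0)
  have h3 := h (Pi.single 1 (1, 0), 0)
  have h4 := h (Pi.single 1 (0, 1), 0)
  have h5 := h (0, (1, 0))
  have h6 := h (0, (0, 1))
  simp [vBilin_apply, hΔ] at h1 h2 h3 h4 h5 h6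
  ext i <;> (try fin_cases i) <;> assumption

/-- `D / L` contains an isotropic line unless `L` is self-dual. -/
theorem exists_isotropic_notMem (hodd : Odd p) (hΔunit : ‖Δ‖ = 1) (hΔns : ¬ IsSquare Δ)
    {L D : Submodule ℤ_[p] ((Fin 2 → ℚ_[p] × ℚ_[p]) × (ℚ_[p] × ℚ_[p]))}
    (hFG : L.FG) (hspan : Submodule.span ℚ_[p]
      (L : Set ((Fin 2 → ℚ_[p] × ℚ_[p]) × (ℚ_[p] × ℚ_[p]))) = ⊤)
    (hLD : L ≤ D) (hpL : ∀ x ∈ D, (p : ℚ_[p]) • x ∈ L)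
    (hD : ∀ x, x ∈ D ↔ ∀ l ∈ L, vBilin p Δ x l ∈ PadicInt.subring p) (hne : ¬ D ≤ L) :
    ∃ e ∈ D, e ∉ L ∧ vBilin p Δ e e ∈ PadicInt.subring p := by
  by_contra! hcon
  have haniso : ∀ x ∈ D, vBilin p Δ x x ∈ PadicInt.subring p → x ∈ L := fun x hx hxx =>
    by_contra fun h => hcon x hx h hxx
  have hΔ : Δ ≠ 0 := norm_ne_zero_iff.1 (by simp [hΔunit])
  refine hne fun x hx => ?_
  have hli : LinearIndependent ℚ_[p]
      ![((Pi.single 0 (1, 0), 0) : (Fin 2 → ℚ_[p] × ℚ_[p]) × (ℚ_[p] × ℚ_[p])),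
        (Pi.single 1 (1, 0), 0)] := by
    rw [LinearIndependent.pair_iff]
    intro s t h
    have h0 := congrArg (fun z => (z.1 0).1) h
    have h1 := congrArg (fun z => (z.1 1).1) h
    simp at h0 h1
    exact ⟨h0, h1⟩
  obtain ⟨l, hl, h0, h1⟩ := exists_sub_mem_orthogonal hFG hspan (vBilin_nondegenerate hΔ)
    vBilin_isSymm hLD hD haniso hli (by simp [vBilin_apply]) (by simp [vBilin_apply])
    (by simp [vBilin_apply]) hx
  have hyD : x - l ∈ D := D.sub_mem hx (hLD hl)
  rw [← sub_add_cancel x l]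
  refine L.add_mem ?_ hl
  generalize x - l = y at h0 h1 hyD
  have hpy := (hD y).1 hyD _ (hpL y hyD)
  have hyy : vBilin p Δ y y = 2 * (y.2.1 ^ 2 - Δ * y.2.2 ^ 2) := by
    simp [vBilin_apply] at h0 h1 ⊢
    simp [h0, h1]
    ring
  have h2 := Padic.norm_two_of_odd hodd
  have hp : (0 : ℝ) < p := by exact_mod_cast (Fact.out : p.Prime).pos
  refine haniso y hyD ?_
  rw [PadicInt.mem_subring_iff, map_smul, hyy, smul_eq_mul, norm_mul, norm_mul, h2, one_mul,
    Padic.norm_p, Padic.norm_sq_sub_mul_sq hodd hΔunit hΔns, inv_mul_le_one₀ hp, max_le_iff] at hpy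
  rw [PadicInt.mem_subring_iff, hyy, norm_mul, h2, one_mul,
    Padic.norm_sq_sub_mul_sq hodd hΔunit hΔns]
  exact max_le (pow_le_one₀ (norm_nonneg _) (Padic.norm_le_one_of_sq_le hpy.1))
    (pow_le_one₀ (norm_nonneg _) (Padic.norm_le_one_of_sq_le hpy.2))

end Form

/-- Let `p` be an odd prime and `V₀` the `6`-dimensional quadratic space over `ℚ_p`
which is the orthogonal sum of two hyperbolic planes and the norm form of the
unramified quadratic extension `ℚ_{p²}/ℚ_p` (realized as `x² - Δy²`, `Δ` a nonsquare
unit).  Let `L` be a `ℤ_p`-lattice with `L ⊆ L^* ⊆ p⁻¹·L` and `dim_{𝔽_p}(L^*/L) = 2`,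
where `L^*` is the dual lattice with respect to the bilinear form
`[x,y] = Q(x+y) - Q(x) - Q(y)`.  Then the induced `𝔽_p`-quadratic space `L^*/L`
(with the form induced by `p·Q` mod `p`) is a hyperbolic plane: it has a hyperbolic
basis, and in particular it contains exactly two isotropic lines.  (A line of `L^*/L`
is an intermediate lattice `M = L + ℤ_p·x` with `x ∈ L^* \ L`; it is isotropic when
`p·Q` vanishes mod `p` on it, i.e. `‖Q y‖ ≤ 1` for all `y ∈ M`.) -/
theorem stmt16 (p : ℕ) [Fact p.Prime] (hodd : Odd p)
    (Δ : ℚ_[p]) (hΔunit : ‖Δ‖ = 1) (hΔns : ¬ IsSquare Δ)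
    (L : Submodule ℤ_[p] ((Fin 2 → ℚ_[p] × ℚ_[p]) × (ℚ_[p] × ℚ_[p])))
    (hFG : L.FG)
    (hspan : Submodule.span ℚ_[p]
        (L : Set ((Fin 2 → ℚ_[p] × ℚ_[p]) × (ℚ_[p] × ℚ_[p]))) = ⊤)
    (Lstar : Submodule ℤ_[p] ((Fin 2 → ℚ_[p] × ℚ_[p]) × (ℚ_[p] × ℚ_[p])))
    (hLstar : (Lstar : Set ((Fin 2 → ℚ_[p] × ℚ_[p]) × (ℚ_[p] × ℚ_[p])))
        = {x | ∀ l ∈ L, ‖vForm p Δ (x + l) - vForm p Δ x - vForm p Δ l‖ ≤ 1})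
    (hLL : L ≤ Lstar)
    (hpL : ∀ x ∈ Lstar, (p : ℚ_[p]) • x ∈ L)
    (hindex : Nat.card (↥Lstar ⧸ (L.comap Lstar.subtype)) = p ^ 2) :
    (∃ e ∈ Lstar, ∃ f ∈ Lstar,
        ‖vForm p Δ e‖ ≤ 1 ∧ ‖vForm p Δ f‖ ≤ 1 ∧
        ‖(p : ℚ_[p]) * (vForm p Δ (e + f) - vForm p Δ e - vForm p Δ f) - 1‖ < 1 ∧
        Lstar = L ⊔ Submodule.span ℤ_[p] {e, f}) ∧
    {M : Submodule ℤ_[p] ((Fin 2 → ℚ_[p] × ℚ_[p]) × (ℚ_[p] × ℚ_[p])) |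
        (∃ x ∈ Lstar, x ∉ L ∧ M = L ⊔ Submodule.span ℤ_[p] {x}) ∧
        ∀ y ∈ M, ‖vForm p Δ y‖ ≤ 1}.ncard = 2 := by
  have h2 := Padic.norm_two_of_odd hodd
  have hD : ∀ x, x ∈ Lstar ↔ ∀ l ∈ L, vBilin p Δ x l ∈ PadicInt.subring p := fun x => by
    rw [← SetLike.mem_coe, hLstar]
    simp only [Set.mem_ofPred_eq, vBilin_eq_polar, PadicInt.mem_subring_iff]
  have hQ : ∀ x, vBilin p Δ x x ∈ PadicInt.subring p ↔ ‖vForm p Δ x‖ ≤ 1 := fun x => by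
    rw [PadicInt.mem_subring_iff, vBilin_self, norm_mul, h2, one_mul]
  have hp : p.Prime := Fact.out
  have hne : ¬ Lstar ≤ L := by
    intro h
    rw [Submodule.comap_subtype_eq_top.2 h] at hindex
    have h1 : 1 = p ^ 2 := by rw [← hindex]; simp
    exact (Nat.one_lt_pow two_ne_zero hp.one_lt).ne h1
  have hB : (vBilin p Δ).IsSymm := vBilin_isSymm
  obtain ⟨e, he, heL, hee⟩ :=
    exists_isotropic_notMem hodd hΔunit hΔns hFG hspan hLL hpL hD hne
  have hΔ : Δ ≠ 0 := norm_ne_zero_iff.1 (by simp [hΔunit])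
  obtain ⟨f, hf, hff, hpef⟩ := exists_hyperbolic_pair hB h2 hpL hD
    (mem_of_pairing_dual_integral hFG hspan (vBilin_nondegenerate hΔ) hB hD) he heL hee
  have hef : vBilin p Δ e f ∉ PadicInt.subring p := by
    intro h
    have hlt : ‖(p : ℚ_[p]) * vBilin p Δ e f‖ < 1 := by
      rw [norm_mul]
      exact mul_lt_one_of_nonneg_of_lt_one_left (norm_nonneg _) Padic.norm_p_lt_one
        ((PadicInt.mem_subring_iff p).1 h)
    have := (IsUltrametricDist.norm_add_le_max ((p : ℚ_[p]) * vBilin p Δ e f)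
      (-((p : ℚ_[p]) * vBilin p Δ e f - 1))).trans_lt (max_lt hlt (by rwa [norm_neg]))
    simp at this
  have hsup := dual_eq_sup_span_pair hB hLL hD hindex he hf hee hff hef
  refine ⟨⟨e, he, f, hf, (hQ e).1 hee, (hQ f).1 hff, ?_, hsup⟩, ?_⟩
  · rwa [vBilin_eq_polar]
  · simpa only [hQ] using ncard_isotropic_lines hB h2 hLL hpL hD he hf hee hff hef hsup
end
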